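/- arXiv:1611.10287 — 10 statements merged into one kernel-verified Lean document; each statement's English description precedes it below -/
import Mathlib

section
/- For every Λ > 0 and every triple of positive reals (A, 𝒥, Q), there exists a unique Â with 0 < Â ≤ 4π/Λ such that the rescaled triple (Â, 𝒥̂, Q̂) := (Â, 𝒥Â²/A², QÂ/A) satisfies inequality (I) with equality, i.e. 𝒥̂² + Q̂⁴/4 = (Â²/(64π²))[(1 − ΛÂ/(4π))(1 − ΛÂ/(12π)) − (2/3)ΛQ̂²]. (Existence-and-uniqueness part of Lemma 3.2.) -/
open Real

theorem existsUnique_mul_sq_eq {k p : ℝ} (hk : 0 < k) (hp : 0 < p) :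
    ∃! x : ℝ, (0 < x ∧ x ≤ 1 / p) ∧ k * x ^ 2 = (1 - p * x) * (1 - p * x / 3) := by
  have hlt : ∀ x y : ℝ, 0 < x → x < y → y ≤ 1 / p →
      k * x ^ 2 = (1 - p * x) * (1 - p * x / 3) →
      k * y ^ 2 ≠ (1 - p * y) * (1 - p * y / 3) := by
    intro x y hx hxy hy ex ey
    have hpy : p * y ≤ 1 := by rwa [le_div_iff₀ hp, mul_comm] at hy
    have hpxy : p * x < p * y := mul_lt_mul_of_pos_left hxy hp
    have hsq : k * x ^ 2 < k * y ^ 2 := by gcongr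
    nlinarith [mul_nonneg (sub_nonneg.2 hpxy.le) (show 0 ≤ 4 - p * x - p * y by linarith)]
  obtain ⟨x, ⟨hx0, hx1⟩, hx⟩ := intermediate_value_Icc (by positivity : (0 : ℝ) ≤ 1 / p)
    (f := fun x => k * x ^ 2 - (1 - p * x) * (1 - p * x / 3)) (by fun_prop)
    (show (0 : ℝ) ∈ Set.Icc _ _ by
      constructor
      · norm_num
      · have : p * (1 / p) = 1 := by field_simp
        simp only [this]
        have : 0 < k * (1 / p) ^ 2 := by positivity
        linarith)
  have hx : k * x ^ 2 = (1 - p * x) * (1 - p * x / 3) := sub_eq_zero.1 hx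
  have hxpos : 0 < x := hx0.lt_of_ne (by rintro rfl; norm_num at hx)
  refine ⟨x, ⟨⟨hxpos, hx1⟩, hx⟩, ?_⟩
  rintro y ⟨⟨hy0, hy1⟩, hy⟩
  rcases lt_trichotomy y x with h | h | h
  · exact absurd hx (hlt y x hy0 h hx1 hy)
  · exact h
  · exact absurd hy (hlt x y hxpos h hy1 hx)

/-- Existence-and-uniqueness part of Lemma 3.2: for every `Λ > 0` and positive triple
`(A, J, Q)` there is a unique `Ahat` with `0 < Ahat ≤ 4π/Λ` such that the rescaled triple
`(Ahat, J Ahat²/A², Q Ahat/A)` saturates inequality (I). -/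
theorem statement0 (Λ A J Q : ℝ) (hΛ : 0 < Λ) (hA : 0 < A) (hJ : 0 < J) (hQ : 0 < Q) :
    ∃! Ahat : ℝ, (0 < Ahat ∧ Ahat ≤ 4 * π / Λ) ∧
      (J * Ahat ^ 2 / A ^ 2) ^ 2 + (Q * Ahat / A) ^ 4 / 4 =
        Ahat ^ 2 / (64 * π ^ 2) *
          ((1 - Λ * Ahat / (4 * π)) * (1 - Λ * Ahat / (12 * π)) - 2 / 3 * Λ * (Q * Ahat / A) ^ 2) := by
  have hπ := Real.pi_pos
  have key := existsUnique_mul_sq_eq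
    (k := 64 * π ^ 2 * (J ^ 2 + Q ^ 4 / 4) / A ^ 4 + 2 / 3 * Λ * Q ^ 2 / A ^ 2)
    (p := Λ / (4 * π)) (by positivity) (by positivity)
  refine (existsUnique_congr fun x => ?_).mp key
  rw [one_div_div]
  refine and_congr_right fun hx => ?_
  have hc : 0 < x ^ 2 / (64 * π ^ 2) := by have := hx.1; positivity
  rw [← mul_right_inj' hc.ne', ← sub_eq_zero, ← sub_eq_zero (a := _ + _)]
  refine Eq.congr_left ?_
  field_simp
  ring
end

section
/- Let Λ > 0 and A, 𝒥, Q > 0, and let Â ∈ (0, 4π/Λ] be the unique value such that (Â, 𝒥Â²/A², QÂ/A) saturates inequality (I). If A ≤ Â, then the triple (A, 𝒥, Q) satisfies inequality (I). (One direction of the equivalence in Lemma 3.2.) -/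
open Real

/-- One direction of the equivalence in Lemma 3.2: if `Ahat ∈ (0, 4π/Λ]` is the value for which
the rescaled triple `(Ahat, J Ahat²/A², Q Ahat/A)` saturates inequality (I), and `A ≤ Ahat`, then the
triple `(A, J, Q)` satisfies inequality (I). -/
theorem statement1 (Λ A J Q Ahat : ℝ) (hΛ : 0 < Λ) (hA : 0 < A) (hJ : 0 < J) (hQ : 0 < Q)
    (hAhatpos : 0 < Ahat) (hAhatle : Ahat ≤ 4 * π / Λ)
    (hsat : (J * Ahat ^ 2 / A ^ 2) ^ 2 + (Q * Ahat / A) ^ 4 / 4 =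
      Ahat ^ 2 / (64 * π ^ 2) *
        ((1 - Λ * Ahat / (4 * π)) * (1 - Λ * Ahat / (12 * π)) - 2 / 3 * Λ * (Q * Ahat / A) ^ 2))
    (hAAhat : A ≤ Ahat) :
    J ^ 2 + Q ^ 4 / 4 ≤ A ^ 2 / (64 * π ^ 2) *
      ((1 - Λ * A / (4 * π)) * (1 - Λ * A / (12 * π)) - 2 / 3 * Λ * Q ^ 2) := by
  have hπ := Real.pi_pos
  set f : ℝ → ℝ := fun x => (1 - Λ * x / (4 * π)) * (1 - Λ * x / (12 * π))
  obtain ⟨t, rfl⟩ : ∃ t, Ahat = t * A := ⟨Ahat / A, by field_simp⟩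
  have ht : 1 ≤ t := by
    by_contra! h
    nlinarith
  have hJt : J * (t * A) ^ 2 / A ^ 2 = J * t ^ 2 := by field_simp
  have hQt : Q * (t * A) / A = Q * t := by field_simp
  have hu : Λ * (t * A) / (4 * π) ≤ 1 := by
    rw [le_div_iff₀ hΛ] at hAhatle
    rw [div_le_one (by positivity)]
    linarith
  have hv : Λ * (t * A) / (12 * π) ≤ 1 := by
    refine le_trans ?_ hu
    gcongr
    norm_num
  have hu' : Λ * A / (4 * π) ≤ Λ * (t * A) / (4 * π) := by gcongr
  have hv' : Λ * A / (12 * π) ≤ Λ * (t * A) / (12 * π) := by gcongr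
  have hf_nonneg : 0 ≤ f (t * A) := mul_nonneg (by linarith) (by linarith)
  have hf_anti : f (t * A) ≤ f A :=
    mul_le_mul (by linarith) (by linarith) (by linarith) (by linarith)
  have hf_scaled : f (t * A) / t ^ 2 ≤ f A :=
    (div_le_self hf_nonneg (one_le_pow₀ ht)).trans hf_anti
  have hkey : J ^ 2 + Q ^ 4 / 4 =
      A ^ 2 / (64 * π ^ 2) * (f (t * A) / t ^ 2 - 2 / 3 * Λ * Q ^ 2) := by
    have ht0 : t ^ 4 ≠ 0 := by positivity
    have ht1 : t ≠ 0 := by positivity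
    rw [hJt, hQt] at hsat
    change _ = _ * (f (t * A) - _) at hsat
    refine mul_left_cancel₀ ht0 ?_
    calc t ^ 4 * (J ^ 2 + Q ^ 4 / 4) = (J * t ^ 2) ^ 2 + (Q * t) ^ 4 / 4 := by ring
      _ = _ := hsat
      _ = _ := by
        generalize f (t * A) = y
        field_simp
  rw [hkey]
  change _ ≤ _ * (f A - _)
  gcongr
end

section
/- Let Λ > 0 and A, 𝒥, Q > 0 with ΛA ≤ 4π, and let Â ∈ (0, 4π/Λ] be the unique value such that (Â, 𝒥Â²/A², QÂ/A) saturates inequality (I). If the triple (A, 𝒥, Q) satisfies inequality (I), then A ≤ Â. (Converse direction of the equivalence in Lemma 3.2, for areas below the de Sitter bound.) -/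
open Real

/-- Converse direction of the equivalence in Lemma 3.2 (for areas below the de Sitter bound):
if `ΛA ≤ 4π`, `Ahat ∈ (0, 4π/Λ]` saturates inequality (I) for the rescaled triple, and the
triple `(A, J, Q)` satisfies inequality (I), then `A ≤ Ahat`. -/
theorem statement2 (Λ A J Q Ahat : ℝ) (hΛ : 0 < Λ) (hA : 0 < A) (hJ : 0 < J) (hQ : 0 < Q)
    (hΛA : Λ * A ≤ 4 * π)
    (hAhatpos : 0 < Ahat) (hAhatle : Ahat ≤ 4 * π / Λ)
    (hsat : (J * Ahat ^ 2 / A ^ 2) ^ 2 + (Q * Ahat / A) ^ 4 / 4 =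
      Ahat ^ 2 / (64 * π ^ 2) *
        ((1 - Λ * Ahat / (4 * π)) * (1 - Λ * Ahat / (12 * π)) - 2 / 3 * Λ * (Q * Ahat / A) ^ 2))
    (hineq : J ^ 2 + Q ^ 4 / 4 ≤ A ^ 2 / (64 * π ^ 2) *
      ((1 - Λ * A / (4 * π)) * (1 - Λ * A / (12 * π)) - 2 / 3 * Λ * Q ^ 2)) :
    A ≤ Ahat := by
  by_contra! hlt
  obtain ⟨t, rfl⟩ : ∃ t, Ahat = t * A := ⟨Ahat / A, by field_simp⟩
  obtain ⟨x, hx⟩ : ∃ x, x = Λ * A / (4 * π) := ⟨_, rfl⟩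
  obtain ⟨c, hc⟩ : ∃ c, c = A ^ 2 / (64 * π ^ 2) := ⟨_, rfl⟩
  have ht : 0 < t := pos_of_mul_pos_left hAhatpos hA.le
  have ht1 : t < 1 := by nlinarith
  have hx1 : x ≤ 1 := by
    rw [hx, div_le_one (by positivity)]
    exact hΛA
  have hc0 : 0 < c := by rw [hc]; positivity
  have hscaled : t ^ 2 * (J ^ 2 + Q ^ 4 / 4) =
      c * ((1 - t * x) * (1 - t * x / 3) - 2 / 3 * Λ * Q ^ 2 * t ^ 2) := by
    have hJ' : J * (t * A) ^ 2 / A ^ 2 = t ^ 2 * J := by field_simp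
    have hQ' : Q * (t * A) / A = t * Q := by field_simp
    have hx' : Λ * (t * A) / (4 * π) = t * x := by rw [hx]; ring
    have hx'' : Λ * (t * A) / (12 * π) = t * x / 3 := by rw [hx]; field_simp; norm_num
    have hc' : (t * A) ^ 2 / (64 * π ^ 2) = t ^ 2 * c := by rw [hc]; ring
    rw [hJ', hQ', hx', hx'', hc'] at hsat
    apply mul_left_cancel₀ (pow_ne_zero 2 ht.ne')
    linear_combination hsat
  have hx3 : Λ * A / (12 * π) = x / 3 := by rw [hx]; field_simp; norm_num
  rw [← hx, hx3, ← hc] at hineq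
  have hscaled_le := mul_le_mul_of_nonneg_left hineq (sq_nonneg t)
  have hgap : c * ((1 - t) * (1 + t - 4 / 3 * x * t)) ≤ 0 := by
    linarith
  have hgap_pos : 0 < 1 + t - 4 / 3 * x * t := by nlinarith
  exact absurd hgap (not_le.mpr (mul_pos hc0 (mul_pos (sub_pos.mpr ht1) hgap_pos)))
end

section
/- Let 0 ≤ k ≤ 3/2 and set s = √(3 + 4k). Then for every t ∈ [0, 1], (t²/4)·(1 − (4/3)t + (1/3)t² − (2/3)k) ≤ (3 − s)³(1 + s)/192, with equality when t = (3 − s)/2. (The optimization over the area variable used to derive the universal bound (11) from inequality (9).) -/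
open Real

/-- The optimization over the area variable used to derive the universal bound (11):
for `0 ≤ k ≤ 3/2` and `s = √(3 + 4k)`, the function
`F(t) = (t²/4)(1 − (4/3)t + (1/3)t² − (2/3)k)` is bounded on `[0,1]` by
`(3 − s)³(1 + s)/192`, with equality at `t = (3 − s)/2`. -/
theorem statement5 (k s : ℝ) (hk0 : 0 ≤ k) (hk1 : k ≤ 3 / 2)
    (hs : s = Real.sqrt (3 + 4 * k)) :
    (∀ t ∈ Set.Icc (0 : ℝ) 1,
      t ^ 2 / 4 * (1 - 4 / 3 * t + 1 / 3 * t ^ 2 - 2 / 3 * k) ≤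
        (3 - s) ^ 3 * (1 + s) / 192) ∧
    ((3 - s) / 2) ^ 2 / 4 *
        (1 - 4 / 3 * ((3 - s) / 2) + 1 / 3 * ((3 - s) / 2) ^ 2 - 2 / 3 * k) =
      (3 - s) ^ 3 * (1 + s) / 192 := by
  have hsq : s ^ 2 = 3 + 4 * k := by rw [hs, Real.sq_sqrt (by linarith)]
  have hs1 : 1 ≤ s := by rw [hs, Real.one_le_sqrt]; linarith
  have hs3 : s ≤ 3 := by rw [hs, Real.sqrt_le_left (by norm_num)]; linarith
  obtain rfl : k = (s ^ 2 - 3) / 4 := by linarith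
  refine ⟨fun t ⟨ht0, ht1⟩ => ?_, by ring⟩
  have hcofactor : 0 ≤ t * (1 + s - t) + (3 - s) * (1 + s) / 4 := by
    have h₁ : 0 ≤ t * (1 + s - t) := mul_nonneg ht0 (by linarith)
    have h₂ : 0 ≤ (3 - s) * (1 + s) := mul_nonneg (by linarith) (by linarith)
    linarith
  have hgap := mul_nonneg (sq_nonneg (t - (3 - s) / 2)) hcofactor
  linear_combination hgap / 12
end

section
/- Let Λ > 0, A > 0 with ΛA ≤ 4π, and let 𝒥, Q ≥ 0. If the triple (A, 𝒥, Q) satisfies inequality (I), then 𝒥²/(3 + 4ΛQ²)^{3/2} + (3 + 4ΛQ²)^{1/2}/(48Λ²) ≤ 1/(24Λ²). (The universal angular momentum–charge bound (11) of the paper, with the right-hand side 1/(24Λ²) so that both special cases in (10.1) are recovered.) -/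
open Real

/-- The bound in the dimensionless variables `x = ΛA/(4π)`, `s = √(3 + 4ΛQ²)`, `j = Λ²J²`. -/
theorem dimensionless_angular_momentum_bound {x s j : ℝ} (hx : 0 < x) (hx1 : x ≤ 1)
    (hs : 0 ≤ s) (hj : 0 ≤ j)
    (h : j + ((s ^ 2 - 3) / 4) ^ 2 / 4 ≤
      x ^ 2 / 4 * ((1 - x) * (1 - x / 3) - 2 / 3 * ((s ^ 2 - 3) / 4))) :
    48 * j ≤ s ^ 3 * (2 - s) := by
  have hfac : 0 ≤ (1 - x) * (1 - x / 3) - 2 / 3 * ((s ^ 2 - 3) / 4) :=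
    nonneg_of_mul_nonneg_right (le_trans (by positivity) h) (by positivity)
  have hs3 : s ≤ 3 := by nlinarith
  have hd : 0 ≤ 2 * (2 * x + s) + 3 - (2 * x - s) ^ 2 := by
    nlinarith [mul_nonneg hs (sub_nonneg.2 hs3), mul_nonneg hx.le (sub_nonneg.2 hx1),
      mul_nonneg hx.le hs, mul_nonneg hx.le (sub_nonneg.2 hs3),
      mul_nonneg hs (sub_nonneg.2 hx1)]
  nlinarith [mul_nonneg (sq_nonneg (2 * x + s - 3)) hd]

/-- The universal angular momentum–charge bound (11): if `Λ > 0`, `0 < A` with `ΛA ≤ 4π`,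
`J, Q ≥ 0` and the triple `(A, J, Q)` satisfies inequality (I), then
`J²/(3 + 4ΛQ²)^{3/2} + (3 + 4ΛQ²)^{1/2}/(48Λ²) ≤ 1/(24Λ²)`. -/
theorem statement6 (Λ A J Q : ℝ) (hΛ : 0 < Λ) (hA : 0 < A) (hΛA : Λ * A ≤ 4 * π)
    (hJ : 0 ≤ J) (hQ : 0 ≤ Q)
    (hineq : J ^ 2 + Q ^ 4 / 4 ≤ A ^ 2 / (64 * π ^ 2) *
      ((1 - Λ * A / (4 * π)) * (1 - Λ * A / (12 * π)) - 2 / 3 * Λ * Q ^ 2)) :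
    J ^ 2 / Real.sqrt (3 + 4 * Λ * Q ^ 2) ^ 3
      + Real.sqrt (3 + 4 * Λ * Q ^ 2) / (48 * Λ ^ 2) ≤ 1 / (24 * Λ ^ 2) := by
  have hq : 0 < 3 + 4 * Λ * Q ^ 2 := by positivity
  have hs : 0 < √(3 + 4 * Λ * Q ^ 2) := sqrt_pos.2 hq
  have hsq : √(3 + 4 * Λ * Q ^ 2) ^ 2 = 3 + 4 * Λ * Q ^ 2 := sq_sqrt hq.le
  have hbound := dimensionless_angular_momentum_bound (x := Λ * A / (4 * π))
    (s := √(3 + 4 * Λ * Q ^ 2)) (j := Λ ^ 2 * J ^ 2) (by positivity)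
    ((div_le_one (by positivity)).2 hΛA) hs.le (by positivity) (by
      rw [hsq]
      calc Λ ^ 2 * J ^ 2 + ((3 + 4 * Λ * Q ^ 2 - 3) / 4) ^ 2 / 4
          = Λ ^ 2 * (J ^ 2 + Q ^ 4 / 4) := by ring
        _ ≤ _ := mul_le_mul_of_nonneg_left hineq (sq_nonneg Λ)
        _ = _ := by ring)
  generalize √(3 + 4 * Λ * Q ^ 2) = s at hs hbound
  have hdiff : 1 / (24 * Λ ^ 2) - (J ^ 2 / s ^ 3 + s / (48 * Λ ^ 2))
      = (s ^ 3 * (2 - s) - 48 * (Λ ^ 2 * J ^ 2)) / (48 * Λ ^ 2 * s ^ 3) := by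
    field_simp
    ring
  rw [← sub_nonneg, hdiff]
  exact div_nonneg (sub_nonneg.2 hbound) (by positivity)
end

section
/- Let Λ > 0 and let 𝒥, Q be real numbers satisfying 𝒥²/(3 + 4ΛQ²)^{3/2} + (3 + 4ΛQ²)^{1/2}/(48Λ²) ≤ 1/(24Λ²). Then 𝒥² ≤ √3(2 − √3)/(16Λ²). (The rotation bound in (10.1) as a consequence of inequality (11).) -/
open Real

/-- The function `s ↦ s³(2 − s)` is decreasing for `s ≥ 3/2`. -/
theorem antitoneOn_cube_mul_two_sub :
    AntitoneOn (fun s : ℝ => s ^ 3 * (2 - s)) (Set.Ici (3 / 2)) := by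
  intro r hr s hs hrs
  rw [Set.mem_Ici] at hr hs
  have hsum : 0 ≤ s + r - 3 := by linarith
  have hfactor : 0 ≤ (s ^ 2 + r ^ 2) * (s + r - 3) + (s - r) ^ 2 := by positivity
  have hdiff := mul_nonneg (sub_nonneg.2 hrs) hfactor
  change s ^ 3 * (2 - s) ≤ r ^ 3 * (2 - r)
  linarith

/-- The rotation bound in (10.1) as a consequence of inequality (11):
if `J²/(3 + 4ΛQ²)^{3/2} + (3 + 4ΛQ²)^{1/2}/(48Λ²) ≤ 1/(24Λ²)` with `Λ > 0`, then
`J² ≤ √3(2 − √3)/(16Λ²)`. -/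
theorem statement7 (Λ J Q : ℝ) (hΛ : 0 < Λ)
    (h : J ^ 2 / Real.sqrt (3 + 4 * Λ * Q ^ 2) ^ 3
      + Real.sqrt (3 + 4 * Λ * Q ^ 2) / (48 * Λ ^ 2) ≤ 1 / (24 * Λ ^ 2)) :
    J ^ 2 ≤ Real.sqrt 3 * (2 - Real.sqrt 3) / (16 * Λ ^ 2) := by
  set s := Real.sqrt (3 + 4 * Λ * Q ^ 2)
  have h3s : Real.sqrt 3 ≤ s :=
    Real.sqrt_le_sqrt (le_add_of_nonneg_right (by positivity))
  have h3 : 3 / 2 ≤ Real.sqrt 3 := Real.le_sqrt_of_sq_le (by norm_num)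
  have hs : 0 < s := by linarith
  have hJ : J ^ 2 / s ^ 3 ≤ (2 - s) / (48 * Λ ^ 2) := by
    calc J ^ 2 / s ^ 3 ≤ 1 / (24 * Λ ^ 2) - s / (48 * Λ ^ 2) := le_sub_iff_add_le.2 h
      _ = (2 - s) / (48 * Λ ^ 2) := by field_simp; ring
  have hmono : s ^ 3 * (2 - s) ≤ Real.sqrt 3 ^ 3 * (2 - Real.sqrt 3) :=
    antitoneOn_cube_mul_two_sub h3 (h3.trans h3s) h3s
  have hcube : Real.sqrt 3 ^ 3 = 3 * Real.sqrt 3 := by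
    rw [pow_succ, Real.sq_sqrt (by norm_num)]
  calc J ^ 2 ≤ (2 - s) / (48 * Λ ^ 2) * s ^ 3 := (div_le_iff₀ (by positivity)).1 hJ
    _ = s ^ 3 * (2 - s) / (48 * Λ ^ 2) := by ring
    _ ≤ Real.sqrt 3 ^ 3 * (2 - Real.sqrt 3) / (48 * Λ ^ 2) := by gcongr
    _ = Real.sqrt 3 * (2 - Real.sqrt 3) / (16 * Λ ^ 2) := by
      rw [hcube]
      ring
end

section
/- Let Λ > 0, A > 0 and let 𝒥, Q be real numbers. If the triple (A, 𝒥, Q) satisfies inequality (I), then either ΛA ≤ 4π or ΛA ≥ 12π. (The Schwarzschild–de Sitter area constraint, first inequality of (10), as an algebraic consequence of (9).) -/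
open Real

/-- The Schwarzschild–de Sitter area constraint (first inequality of (10)): if the triple
`(A, J, Q)` satisfies inequality (I) with `Λ > 0`, `A > 0`, then `ΛA ≤ 4π` or `ΛA ≥ 12π`. -/
theorem statement9 (Λ A J Q : ℝ) (hΛ : 0 < Λ) (hA : 0 < A)
    (hineq : J ^ 2 + Q ^ 4 / 4 ≤ A ^ 2 / (64 * π ^ 2) *
      ((1 - Λ * A / (4 * π)) * (1 - Λ * A / (12 * π)) - 2 / 3 * Λ * Q ^ 2)) :
    Λ * A ≤ 4 * π ∨ 12 * π ≤ Λ * A := by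
  by_contra! h
  obtain ⟨h₁, h₂⟩ := h
  have hπ := pi_pos
  have hneg : 1 - Λ * A / (4 * π) < 0 := sub_neg.mpr ((one_lt_div (by positivity)).mpr h₁)
  have hpos : 0 < 1 - Λ * A / (12 * π) := sub_pos.mpr ((div_lt_one (by positivity)).mpr h₂)
  have hprod := mul_neg_of_neg_of_pos hneg hpos
  have hcharge : 0 ≤ 2 / 3 * Λ * Q ^ 2 := by positivity
  have hlhs : 0 ≤ J ^ 2 + Q ^ 4 / 4 := by positivity
  have hcoeff : 0 < A ^ 2 / (64 * π ^ 2) := by positivity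
  exact absurd (hlhs.trans hineq)
    (mul_neg_of_pos_of_neg hcoeff (by linarith)).not_ge
end

section
/- Let Λ > 0, A > 0 with ΛA ≤ 4π, let Q ≥ 0 and let 𝒥 be real. If the triple (A, 𝒥, Q) satisfies inequality (I), then ΛA² − 4πA + 16π²Q² ≤ 0. (The extreme Reissner–Nordström–de Sitter inequality, second inequality of (10), as a consequence of Theorem 1.1's inequality.) -/
open Real

/-- The extreme Reissner–Nordström–de Sitter inequality (second inequality of (10)):
if `Λ > 0`, `A > 0` with `ΛA ≤ 4π`, `Q ≥ 0` and `(A, J, Q)` satisfies inequality (I), then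
`ΛA² − 4πA + 16π²Q² ≤ 0`. -/
theorem statement10 (Λ A J Q : ℝ) (hΛ : 0 < Λ) (hA : 0 < A) (hΛA : Λ * A ≤ 4 * π)
    (hQ : 0 ≤ Q)
    (hineq : J ^ 2 + Q ^ 4 / 4 ≤ A ^ 2 / (64 * π ^ 2) *
      ((1 - Λ * A / (4 * π)) * (1 - Λ * A / (12 * π)) - 2 / 3 * Λ * Q ^ 2)) :
    Λ * A ^ 2 - 4 * π * A + 16 * π ^ 2 * Q ^ 2 ≤ 0 := by
  obtain ⟨r, rfl⟩ : ∃ r, A = 4 * π * r := ⟨A / (4 * π), by field_simp⟩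
  have hπ := pi_pos
  have hr : 0 < r := pos_of_mul_pos_right hA (by positivity)
  have hx : Λ * r ≤ 1 := by
    refine le_of_mul_le_mul_left ?_ (show 0 < 4 * π by positivity)
    linarith
  have hrhs : (4 * π * r) ^ 2 / (64 * π ^ 2) *
      ((1 - Λ * (4 * π * r) / (4 * π)) * (1 - Λ * (4 * π * r) / (12 * π)) - 2 / 3 * Λ * Q ^ 2)
      = r ^ 2 / 4 * ((1 - Λ * r) * (1 - Λ * r / 3) - 2 / 3 * Λ * Q ^ 2) := by
    field_simp
    ring
  rw [hrhs] at hineq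
  have hfactor : (Q ^ 2 - r * (1 - Λ * r)) *
      (Q ^ 2 + r * (1 - Λ * r) + 2 / 3 * (Λ * r ^ 2)) ≤ 0 := by
    linarith [sq_nonneg J]
  have hpos : 0 < Q ^ 2 + r * (1 - Λ * r) + 2 / 3 * (Λ * r ^ 2) := by
    have := mul_nonneg hr.le (sub_nonneg.2 hx)
    positivity
  have hcharge : Q ^ 2 - r * (1 - Λ * r) ≤ 0 := nonpos_of_mul_nonpos_left hfactor hpos
  calc Λ * (4 * π * r) ^ 2 - 4 * π * (4 * π * r) + 16 * π ^ 2 * Q ^ 2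
      = 16 * π ^ 2 * (Q ^ 2 - r * (1 - Λ * r)) := by ring
    _ ≤ 0 := mul_nonpos_of_nonneg_of_nonpos (by positivity) hcharge
end

section
/- Let Λ > 0, a ∈ ℝ, A > 0, set ζ(θ) = 1 + (a²Λ/3)cos²θ, and let σ, ω, χ, ψ be smooth real-valued functions on [θ₁, θ₂] with 0 < θ₁ < θ₂ < π. With u(θ) := −σ(θ)/2 − log sinθ, the following identity holds: ∫_{θ₁}^{θ₂} { (1 + Λa²cos²θ)σ + ζ[ σ'²/4 + e^{−2σ}(ω' + χψ' − ψχ')²/sin⁴θ + e^{−σ}(χ'² + ψ'²)/sin²θ + Λ(A/4π)²e^{−σ} ] } sinθ dθ = ∫_{θ₁}^{θ₂} ζ[ u'² + e^{4u}(ω' + χψ' − ψχ')² + e^{2u}(χ'² + ψ'²) + Λ(A/4π)²e^{2u}sin²θ ] sinθ dθ − ∫_{θ₁}^{θ₂} (1 + Λa²cos²θ)(log sinθ) sinθ dθ − [ ζ(θ)cosθ·(σ(θ) + log sinθ) ]_{θ=θ₁}^{θ=θ₂}. (Equation (60): the area functional is the quasi-harmonic map energy plus an explicit constant and boundary terms,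 with the exact boundary contribution.) -/
open Real

/-- Equation (60): on `[θ₁, θ₂] ⊂ (0, π)`, the area functional density equals the
quasi-harmonic map energy density (with `u = −σ/2 − log sinθ`, so
`u' = −σ'/2 − cosθ/sinθ`) plus the explicit `log sinθ` term and an exact boundary term. -/
theorem statement12 (Λ a A θ₁ θ₂ : ℝ) (hΛ : 0 < Λ) (hA : 0 < A)
    (h1 : 0 < θ₁) (h12 : θ₁ < θ₂) (h2 : θ₂ < π)
    (σ ω χ ψ σ' ω' χ' ψ' : ℝ → ℝ)
    (hσ : ∀ θ ∈ Set.Icc θ₁ θ₂, HasDerivAt σ (σ' θ) θ)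
    (hω : ∀ θ ∈ Set.Icc θ₁ θ₂, HasDerivAt ω (ω' θ) θ)
    (hχ : ∀ θ ∈ Set.Icc θ₁ θ₂, HasDerivAt χ (χ' θ) θ)
    (hψ : ∀ θ ∈ Set.Icc θ₁ θ₂, HasDerivAt ψ (ψ' θ) θ)
    (hσ' : ContinuousOn σ' (Set.Icc θ₁ θ₂))
    (hω' : ContinuousOn ω' (Set.Icc θ₁ θ₂))
    (hχ' : ContinuousOn χ' (Set.Icc θ₁ θ₂))
    (hψ' : ContinuousOn ψ' (Set.Icc θ₁ θ₂)) :
    (∫ θ in θ₁..θ₂,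
        ((1 + Λ * a ^ 2 * Real.cos θ ^ 2) * σ θ
          + (1 + a ^ 2 * Λ / 3 * Real.cos θ ^ 2) *
            ((σ' θ) ^ 2 / 4
              + Real.exp (-(2 * σ θ)) * (ω' θ + χ θ * ψ' θ - ψ θ * χ' θ) ^ 2
                  / Real.sin θ ^ 4
              + Real.exp (-σ θ) * ((χ' θ) ^ 2 + (ψ' θ) ^ 2) / Real.sin θ ^ 2
              + Λ * (A / (4 * π)) ^ 2 * Real.exp (-σ θ))) * Real.sin θ) =
      (∫ θ in θ₁..θ₂,
        (1 + a ^ 2 * Λ / 3 * Real.cos θ ^ 2) *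
          ((-(σ' θ) / 2 - Real.cos θ / Real.sin θ) ^ 2
            + Real.exp (4 * (-(σ θ) / 2 - Real.log (Real.sin θ)))
                * (ω' θ + χ θ * ψ' θ - ψ θ * χ' θ) ^ 2
            + Real.exp (2 * (-(σ θ) / 2 - Real.log (Real.sin θ)))
                * ((χ' θ) ^ 2 + (ψ' θ) ^ 2)
            + Λ * (A / (4 * π)) ^ 2
                * Real.exp (2 * (-(σ θ) / 2 - Real.log (Real.sin θ)))
                * Real.sin θ ^ 2) * Real.sin θ)
      - (∫ θ in θ₁..θ₂,
          (1 + Λ * a ^ 2 * Real.cos θ ^ 2) * Real.log (Real.sin θ) * Real.sin θ)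
      - ((1 + a ^ 2 * Λ / 3 * Real.cos θ₂ ^ 2) * Real.cos θ₂
            * (σ θ₂ + Real.log (Real.sin θ₂))
          - (1 + a ^ 2 * Λ / 3 * Real.cos θ₁ ^ 2) * Real.cos θ₁
            * (σ θ₁ + Real.log (Real.sin θ₁))) := by
  have hs : ∀ θ ∈ Set.Icc θ₁ θ₂, 0 < Real.sin θ := fun θ hθ =>
    Real.sin_pos_of_pos_of_lt_pi (h1.trans_le hθ.1) (hθ.2.trans_lt h2)
  have hs0 : ∀ θ ∈ Set.Icc θ₁ θ₂, Real.sin θ ≠ 0 := fun θ hθ => (hs θ hθ).ne'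
  have cσ : ContinuousOn σ (Set.Icc θ₁ θ₂) := HasDerivAt.continuousOn hσ
  have cχ : ContinuousOn χ (Set.Icc θ₁ θ₂) := HasDerivAt.continuousOn hχ
  have cψ : ContinuousOn ψ (Set.Icc θ₁ θ₂) := HasDerivAt.continuousOn hψ
  have cG : ContinuousOn (fun θ =>
      -((1 + Λ * a ^ 2 * Real.cos θ ^ 2) * Real.sin θ * (σ θ + Real.log (Real.sin θ)))
      + (1 + a ^ 2 * Λ / 3 * Real.cos θ ^ 2) * Real.cos θ *
        (σ' θ + Real.cos θ / Real.sin θ)) (Set.Icc θ₁ θ₂) := by fun_prop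
  rw [← Set.uIcc_of_le h12.le] at cG
  rw [← intervalIntegral.integral_eq_sub_of_hasDerivAt (a := θ₁) (b := θ₂)
      (f := fun θ => (1 + a ^ 2 * Λ / 3 * Real.cos θ ^ 2) * Real.cos θ
        * (σ θ + Real.log (Real.sin θ))) ?_ cG.intervalIntegrable,
    ← intervalIntegral.integral_sub, ← intervalIntegral.integral_sub _ cG.intervalIntegrable]
  · apply intervalIntegral.integral_congr
    intro θ hθ
    rw [Set.uIcc_of_le h12.le] at hθ
    have hpos := hs θ hθ
    have hne := hpos.ne'
    have e2 : Real.exp (2 * (-(σ θ) / 2 - Real.log (Real.sin θ)))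
        = Real.exp (-σ θ) / Real.sin θ ^ 2 := by
      rw [show 2 * (-(σ θ) / 2 - Real.log (Real.sin θ))
          = -σ θ - (2 : ℕ) * Real.log (Real.sin θ) by push_cast; ring,
        Real.exp_sub, Real.exp_nat_mul, Real.exp_log hpos]
    have e4 : Real.exp (4 * (-(σ θ) / 2 - Real.log (Real.sin θ)))
        = Real.exp (-(2 * σ θ)) / Real.sin θ ^ 4 := by
      rw [show 4 * (-(σ θ) / 2 - Real.log (Real.sin θ))
          = -(2 * σ θ) - (4 : ℕ) * Real.log (Real.sin θ) by push_cast; ring,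
        Real.exp_sub, Real.exp_nat_mul, Real.exp_log hpos]
    simp only [e2, e4]
    field_simp
    ring
  · apply ContinuousOn.intervalIntegrable
    rw [Set.uIcc_of_le h12.le]
    fun_prop
  · apply ContinuousOn.intervalIntegrable
    rw [Set.uIcc_of_le h12.le]
    fun_prop
  · apply ContinuousOn.intervalIntegrable
    rw [Set.uIcc_of_le h12.le]
    fun_prop
  · intro θ hθ
    rw [Set.uIcc_of_le h12.le] at hθ
    have hne := hs0 θ hθ
    have hc := Real.hasDerivAt_cos θ
    have key := (((((hc.pow 2).const_mul (a ^ 2 * Λ / 3)).const_add 1).mul hc).mul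
      ((hσ θ hθ).add ((Real.hasDerivAt_sin θ).log hne)))
    refine key.congr_deriv ?_
    simp only [Pi.pow_apply, Pi.mul_apply, Pi.add_apply]
    push_cast
    ring
end

section
/- Let Λ > 0, a ∈ ℝ, A > 0, ζ(θ) = 1 + (a²Λ/3)cos²θ, and define the functional I(σ, ω, χ, ψ) = ∫₀^π { (1 + Λa²cos²θ)σ + ζ[ σ'²/4 + e^{−2σ}(ω' + χψ' − ψχ')²/sin⁴θ + e^{−σ}(χ'² + ψ'²)/sin²θ + Λ(A/4π)²e^{−σ} ] } sinθ dθ. Let (σ, ω, χ, ψ) and (σ₀, ω₀, χ₀, ψ₀) be smooth on [0, π] with: σ and σ₀ bounded; σ', ω', χ', ψ', ω₀', χ₀', ψ₀' all O(sinθ) as θ → 0 and θ → π; ω₀' + χ₀ψ₀' − ψ₀χ₀' = O(sin³θ); ω' + χψ' − ψχ' = O(sin^{1+δ}θ) for some δ > 0; and ω = ω₀, χ = χ₀, ψ = ψ₀ at θ = 0 and θ = π. For ε > 0 let φ_ε(θ) = 0 where sinθ ≤ ε, φ_ε(θ) = log(sinθ/ε)/log(√ε/ε) where ε < sinθ < √ε,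 and φ_ε(θ) = 1 where sinθ ≥ √ε, and set Ψ_ε = (σ, ω₀ + φ_ε(ω − ω₀), χ₀ + φ_ε(χ − χ₀), ψ₀ + φ_ε(ψ − ψ₀)). Then I(Ψ_ε) → I(σ, ω, χ, ψ) as ε → 0. (Lemma 4.2: cut-and-paste approximation leaves the area functional unchanged in the limit.) -/
open Real

/-- The axisymmetric reduction of the area functional `𝓘_a` of equation (47). -/
noncomputable def areaFunctional (Λ a A : ℝ) (σ ω χ ψ : ℝ → ℝ) : ℝ :=
  ∫ θ in (0 : ℝ)..π,
    ((1 + Λ * a ^ 2 * Real.cos θ ^ 2) * σ θ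
      + (1 + a ^ 2 * Λ / 3 * Real.cos θ ^ 2) *
        ((deriv σ θ) ^ 2 / 4
          + Real.exp (-(2 * σ θ)) *
              (deriv ω θ + χ θ * deriv ψ θ - ψ θ * deriv χ θ) ^ 2 / Real.sin θ ^ 4
          + Real.exp (-σ θ) * ((deriv χ θ) ^ 2 + (deriv ψ θ) ^ 2) / Real.sin θ ^ 2
          + Λ * (A / (4 * π)) ^ 2 * Real.exp (-σ θ))) * Real.sin θ

/-- The logarithmic cut-off function `φ_ε` of equation (67). -/
noncomputable def cutoff (ε θ : ℝ) : ℝ :=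
  if Real.sin θ ≤ ε then 0
  else if Real.sin θ < Real.sqrt ε then
    Real.log (Real.sin θ / ε) / Real.log (Real.sqrt ε / ε)
  else 1

lemma pow_three_le_rpow {s p : ℝ} (hs : 0 < s) (hs1 : s ≤ 1) (hp : p ≤ 3) : s ^ 3 ≤ s ^ p := by
  rw [← rpow_natCast]
  exact rpow_le_rpow_of_exponent_ge hs hs1 (by exact_mod_cast hp)

lemma le_pi_div_two_mul_sin {θ : ℝ} (h0 : 0 ≤ θ) (h1 : θ ≤ π / 2) : θ ≤ π / 2 * sin θ := by
  have h := mul_le_sin h0 h1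
  have hπ := pi_pos
  calc θ = π / 2 * (2 / π * θ) := by field_simp
    _ ≤ _ := by gcongr

lemma abs_le_sin_rpow_of_abs_deriv_le_of_le_pi_div_two {f f' : ℝ → ℝ} {C p : ℝ} (hp : 0 ≤ p)
    (hC : 0 ≤ C) (hf : ContinuousOn f (Set.Icc 0 π))
    (hd : ∀ θ ∈ Set.Ioo 0 π, HasDerivAt f (f' θ) θ) (h0 : f 0 = 0)
    (hb : ∀ θ ∈ Set.Ioo 0 π, |f' θ| ≤ C * sin θ ^ p) {θ : ℝ} (hθ : 0 < θ) (hθ2 : θ ≤ π / 2) :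
    |f θ| ≤ C * (π / 2) * sin θ ^ (p + 1) := by
  have hπ := pi_pos
  obtain ⟨c, hc, hfc⟩ := exists_hasDerivAt_eq_slope f f' hθ
    (hf.mono (Set.Icc_subset_Icc_right (by linarith)))
    (fun t ht => hd t ⟨ht.1, by linarith [ht.2]⟩)
  have hcπ : c ∈ Set.Ioo 0 π := ⟨hc.1, by linarith [hc.2]⟩
  have hfθ : f θ = f' c * θ := by
    rw [hfc, h0, sub_zero, sub_zero, div_mul_cancel₀ _ hθ.ne']
  have hsc : sin c ≤ sin θ := sin_le_sin_of_le_of_le_pi_div_two (by linarith [hc.1]) hθ2 hc.2.le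
  have hsc0 : 0 < sin c := sin_pos_of_mem_Ioo hcπ
  have hsθ : 0 < sin θ := hsc0.trans_le hsc
  rw [hfθ, abs_mul, abs_of_pos hθ]
  calc |f' c| * θ ≤ (C * sin θ ^ p) * (π / 2 * sin θ) := by
        refine mul_le_mul ((hb c hcπ).trans ?_) (le_pi_div_two_mul_sin hθ.le hθ2) hθ.le
          (by positivity)
        gcongr
    _ = _ := by rw [rpow_add_one hsθ.ne']; ring

/-- A function vanishing at both poles whose derivative is `O(sin ^ p)` is `O(sin ^ (p + 1))`. -/
lemma abs_le_sin_rpow_of_abs_deriv_le {f f' : ℝ → ℝ} {C p : ℝ} (hp : 0 ≤ p) (hC : 0 ≤ C)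
    (hf : ContinuousOn f (Set.Icc 0 π)) (hd : ∀ θ ∈ Set.Ioo 0 π, HasDerivAt f (f' θ) θ)
    (h0 : f 0 = 0) (hπ : f π = 0) (hb : ∀ θ ∈ Set.Ioo 0 π, |f' θ| ≤ C * sin θ ^ p) :
    ∀ θ ∈ Set.Ioo 0 π, |f θ| ≤ C * (π / 2) * sin θ ^ (p + 1) := by
  intro θ hθ
  rcases le_total θ (π / 2) with h | h
  · exact abs_le_sin_rpow_of_abs_deriv_le_of_le_pi_div_two hp hC hf hd h0 hb hθ.1 h
  · have hmem : ∀ t ∈ Set.Ioo 0 π, π - t ∈ Set.Ioo 0 π := fun t ht =>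
      ⟨by linarith [ht.2], by linarith [ht.1]⟩
    have := abs_le_sin_rpow_of_abs_deriv_le_of_le_pi_div_two (f := fun t => f (π - t))
      (f' := fun t => -f' (π - t)) hp hC
      (hf.comp (by fun_prop) fun t ht => ⟨by linarith [ht.2], by linarith [ht.1]⟩)
      (fun t ht => by
        simpa [Function.comp_def] using
          (hd _ (hmem t ht)).scomp t ((hasDerivAt_id t).const_sub π))
      (by simpa using hπ)
      (fun t ht => by simpa [abs_neg, sin_pi_sub] using hb _ (hmem t ht))
      (θ := π - θ) (by linarith [hθ.2]) (by linarith)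
    simpa [sin_pi_sub] using this

lemma one_le_log_sqrt_div {ε : ℝ} (hε : 0 < ε) (hε2 : ε ≤ exp (-2)) : 1 ≤ log (√ε / ε) := by
  rw [log_div (sqrt_ne_zero'.2 hε) hε.ne', log_sqrt hε.le]
  have := (log_le_iff_le_exp hε).2 hε2
  linarith

lemma cutoff_mem_Icc {ε : ℝ} (hε : 0 < ε) (hε2 : ε ≤ exp (-2)) (θ : ℝ) :
    cutoff ε θ ∈ Set.Icc 0 1 := by
  have hL := one_le_log_sqrt_div hε hε2
  unfold cutoff
  split_ifs with h1 h2
  · simp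
  · push Not at h1
    refine ⟨div_nonneg (log_nonneg ((one_le_div hε).2 h1.le)) (by linarith), ?_⟩
    rw [div_le_one (by linarith)]
    exact log_le_log (div_pos (hε.trans h1) hε) (by gcongr)
  · simp

lemma measurable_cutoff (ε : ℝ) : Measurable (cutoff ε) := by
  unfold cutoff
  refine Measurable.ite (measurableSet_le (by fun_prop) (by fun_prop)) (by fun_prop)
    (Measurable.ite (measurableSet_lt (by fun_prop) (by fun_prop)) (by fun_prop) (by fun_prop))

lemma cutoff_eventuallyEq_one {ε θ : ℝ} (hε : 0 < ε) (hε1 : ε ≤ 1) (h : √ε < sin θ) :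
    cutoff ε =ᶠ[nhds θ] fun _ => 1 := by
  filter_upwards [continuous_sin.continuousAt.eventually (lt_mem_nhds h)] with t ht
  have : ε ≤ √ε := le_sqrt_of_sq_le (by nlinarith)
  simp [cutoff, not_le.2 (this.trans_lt ht), not_lt.2 ht.le]

lemma exists_hasDerivAt_cutoff {ε θ : ℝ} (hε : 0 < ε) (hε2 : ε ≤ exp (-2)) (hs : 0 < sin θ)
    (h1 : sin θ ≠ ε) (h2 : sin θ ≠ √ε) :
    ∃ d, HasDerivAt (cutoff ε) d θ ∧ |d| ≤ 1 / sin θ := by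
  have hL := one_le_log_sqrt_div hε hε2
  have hcont : ContinuousAt sin θ := continuous_sin.continuousAt
  rcases lt_or_gt_of_ne h1 with h1 | h1
  · refine ⟨0, (hasDerivAt_const θ (0 : ℝ)).congr_of_eventuallyEq ?_, by simpa using hs.le⟩
    filter_upwards [hcont.eventually (gt_mem_nhds h1)] with t ht
    simp [cutoff, ht.le]
  rcases lt_or_gt_of_ne h2 with h2 | h2
  · refine ⟨cos θ / sin θ / log (√ε / ε), ?_, ?_⟩
    · have hd : HasDerivAt (fun t => log (sin t / ε) / log (√ε / ε))
          (cos θ / sin θ / log (√ε / ε)) θ := by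
        have := (((hasDerivAt_sin θ).div_const ε).log (by positivity)).div_const (log (√ε / ε))
        rwa [div_div_div_cancel_right₀ hε.ne'] at this
      refine hd.congr_of_eventuallyEq ?_
      filter_upwards [hcont.eventually (lt_mem_nhds h1), hcont.eventually (gt_mem_nhds h2)]
        with t ht1 ht2
      simp [cutoff, not_le.2 ht1, ht2]
    · rw [abs_div, abs_div, abs_of_pos hs, abs_of_pos (by linarith : 0 < log (√ε / ε))]
      refine (div_le_self (by positivity) hL).trans ?_
      gcongr
      exact abs_cos_le_one θ
  · exact ⟨0, (hasDerivAt_const θ (1 : ℝ)).congr_of_eventuallyEq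
      (cutoff_eventuallyEq_one hε (hε2.trans (exp_le_one_iff.2 (by norm_num))) h2),
      by simpa using hs.le⟩

lemma intervalIntegrable_sin_rpow {r : ℝ} (hr : -1 < r) (hr0 : r ≤ 0) :
    IntervalIntegrable (fun θ => sin θ ^ r) MeasureTheory.volume 0 π := by
  have h1 : IntervalIntegrable (fun θ : ℝ => θ ^ r) MeasureTheory.volume 0 π :=
    intervalIntegral.intervalIntegrable_rpow' hr
  have h2 : IntervalIntegrable (fun θ : ℝ => (π - θ) ^ r) MeasureTheory.volume 0 π := by
    simpa using (h1.comp_sub_left π).symm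
  have h := (h1.add h2).const_mul ((2 / π) ^ r)
  have hmeas : Measurable fun θ : ℝ => sin θ ^ r := by fun_prop
  refine h.mono_fun hmeas.aestronglyMeasurable ?_
  have hne : ∀ᵐ θ : ℝ, θ ≠ π := by simp [MeasureTheory.ae_iff]
  rw [Set.uIoc_of_le pi_pos.le]
  filter_upwards [MeasureTheory.ae_restrict_mem measurableSet_Ioc,
    MeasureTheory.ae_restrict_of_ae hne] with θ hθ hθπ
  have hθ0 : 0 < θ := hθ.1
  have hθ1 : 0 < π - θ := sub_pos.2 (lt_of_le_of_ne hθ.2 hθπ)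
  have hπ := pi_pos
  have key : ∀ t : ℝ, 0 < t → t ≤ π / 2 → sin t ^ r ≤ (2 / π) ^ r * t ^ r := fun t ht ht2 => by
    rw [← mul_rpow (by positivity) ht.le]
    exact rpow_le_rpow_of_nonpos (by positivity) (mul_le_sin ht.le ht2) hr0
  have hs : 0 < sin θ := sin_pos_of_mem_Ioo ⟨hθ0, by linarith⟩
  rw [norm_of_nonneg (by positivity), norm_of_nonneg (by positivity), mul_add]
  rcases le_total θ (π / 2) with h | h
  · exact (key θ hθ0 h).trans (le_add_of_nonneg_right (by positivity))
  · have := key (π - θ) hθ1 (by linarith)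
    rw [sin_pi_sub] at this
    exact this.trans (le_add_of_nonneg_left (by positivity))

lemma exists_abs_areaDensity_le (Λ a A q S C K : ℝ) :
    ∃ B₁ B₂ : ℝ, ∀ θ s s' T x' y' : ℝ, 0 < sin θ → |s| ≤ S → |s'| ≤ C * sin θ →
      |T| ≤ K * sin θ ^ (1 + q) → |x'| ≤ K * sin θ → |y'| ≤ K * sin θ →
      ‖((1 + Λ * a ^ 2 * cos θ ^ 2) * s
        + (1 + a ^ 2 * Λ / 3 * cos θ ^ 2) *
          (s' ^ 2 / 4 + exp (-(2 * s)) * T ^ 2 / sin θ ^ 4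
            + exp (-s) * (x' ^ 2 + y' ^ 2) / sin θ ^ 2
            + Λ * (A / (4 * π)) ^ 2 * exp (-s))) * sin θ‖
        ≤ B₁ + B₂ * sin θ ^ (2 * q - 1) := by
  refine ⟨(1 + |Λ| * a ^ 2) * S + (1 + a ^ 2 * |Λ| / 3) *
      (C ^ 2 / 4 + exp S * (2 * K ^ 2) + |Λ| * (A / (4 * π)) ^ 2 * exp S),
    (1 + a ^ 2 * |Λ| / 3) * (exp (2 * S) * K ^ 2), ?_⟩
  intro θ s s' T x' y' hs hS hs' hT hx hy
  have hs1 := sin_le_one θ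
  have hc : cos θ ^ 2 ≤ 1 := cos_sq_le_one θ
  have hS' := abs_le.1 hS
  have hsq : ∀ {u b : ℝ}, |u| ≤ b → u ^ 2 ≤ b ^ 2 := fun h =>
    sq_le_sq' (abs_le.1 h).1 (abs_le.1 h).2
  have b1 : |s' ^ 2 / 4 * sin θ| ≤ C ^ 2 / 4 := by
    rw [abs_of_nonneg (by positivity)]
    have h : s' ^ 2 ≤ C ^ 2 := (hsq hs').trans (by
      rw [mul_pow]; exact mul_le_of_le_one_right (sq_nonneg C) (pow_le_one₀ hs.le hs1))
    calc s' ^ 2 / 4 * sin θ ≤ C ^ 2 / 4 * 1 := by gcongr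
      _ = _ := mul_one _
  have b2 : |exp (-(2 * s)) * T ^ 2 / sin θ ^ 4 * sin θ|
      ≤ exp (2 * S) * K ^ 2 * sin θ ^ (2 * q - 1) := by
    rw [abs_of_nonneg (by positivity)]
    have hpow : (sin θ ^ (1 + q)) ^ 2 / sin θ ^ 4 * sin θ = sin θ ^ (2 * q - 1) := by
      rw [← rpow_natCast, ← rpow_natCast (sin θ) 4, ← rpow_mul hs.le, ← rpow_sub hs,
        ← rpow_add_one hs.ne']
      congr 1
      push_cast
      ring
    calc exp (-(2 * s)) * T ^ 2 / sin θ ^ 4 * sin θ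
        ≤ exp (2 * S) * (K * sin θ ^ (1 + q)) ^ 2 / sin θ ^ 4 * sin θ := by
          have := hsq hT
          gcongr
          linarith
      _ = exp (2 * S) * K ^ 2 * ((sin θ ^ (1 + q)) ^ 2 / sin θ ^ 4 * sin θ) := by ring
      _ = _ := by rw [hpow]
  have b3 : |exp (-s) * (x' ^ 2 + y' ^ 2) / sin θ ^ 2 * sin θ| ≤ exp S * (2 * K ^ 2) := by
    rw [abs_of_nonneg (by positivity)]
    calc exp (-s) * (x' ^ 2 + y' ^ 2) / sin θ ^ 2 * sin θ
        ≤ exp S * ((K * sin θ) ^ 2 + (K * sin θ) ^ 2) / sin θ ^ 2 * 1 := by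
          have := hsq hx
          have := hsq hy
          gcongr
          linarith
      _ = _ := by field_simp; ring
  have b4 : |Λ * (A / (4 * π)) ^ 2 * exp (-s) * sin θ| ≤ |Λ| * (A / (4 * π)) ^ 2 * exp S := by
    rw [abs_mul, abs_mul, abs_mul, abs_of_pos hs, abs_of_pos (exp_pos _),
      abs_of_nonneg (sq_nonneg (A / (4 * π)))]
    calc _ ≤ |Λ| * (A / (4 * π)) ^ 2 * exp S * 1 := by
          gcongr
          linarith
      _ = _ := mul_one _
  have c1 : |1 + Λ * a ^ 2 * cos θ ^ 2| ≤ 1 + |Λ| * a ^ 2 := by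
    refine (abs_add_le _ _).trans ?_
    rw [abs_one, abs_mul, abs_mul, abs_of_nonneg (sq_nonneg a), abs_of_nonneg (sq_nonneg (cos θ))]
    gcongr 1 + ?_
    exact mul_le_of_le_one_right (by positivity) hc
  have c2 : |1 + a ^ 2 * Λ / 3 * cos θ ^ 2| ≤ 1 + a ^ 2 * |Λ| / 3 := by
    refine (abs_add_le _ _).trans ?_
    rw [abs_one, abs_mul, abs_div, abs_mul, abs_of_nonneg (sq_nonneg a),
      abs_of_nonneg (sq_nonneg (cos θ)), abs_of_pos (three_pos : (0 : ℝ) < 3)]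
    gcongr 1 + ?_
    exact mul_le_of_le_one_right (by positivity) hc
  have c3 : |s * sin θ| ≤ S := by
    rw [abs_mul, abs_of_pos hs]
    exact (mul_le_of_le_one_right (abs_nonneg s) hs1).trans hS
  rw [norm_eq_abs]
  have split : ∀ u v w₁ w₂ w₃ w₄ : ℝ, (u * s + v * (w₁ + w₂ + w₃ + w₄)) * sin θ =
      u * (s * sin θ) + v * (w₁ * sin θ + w₂ * sin θ + w₃ * sin θ + w₄ * sin θ) := by
    intros; ring
  rw [split]
  refine (abs_add_le _ _).trans ?_
  rw [abs_mul, abs_mul (1 + a ^ 2 * Λ / 3 * cos θ ^ 2)]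
  have b : |s' ^ 2 / 4 * sin θ + exp (-(2 * s)) * T ^ 2 / sin θ ^ 4 * sin θ
      + exp (-s) * (x' ^ 2 + y' ^ 2) / sin θ ^ 2 * sin θ
      + Λ * (A / (4 * π)) ^ 2 * exp (-s) * sin θ| ≤
      C ^ 2 / 4 + exp (2 * S) * K ^ 2 * sin θ ^ (2 * q - 1) + exp S * (2 * K ^ 2)
        + |Λ| * (A / (4 * π)) ^ 2 * exp S :=
    (abs_add_le _ _).trans (add_le_add ((abs_add_le _ _).trans (add_le_add
      ((abs_add_le _ _).trans (add_le_add b1 b2)) b3)) b4)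
  calc _ ≤ (1 + |Λ| * a ^ 2) * S + (1 + a ^ 2 * |Λ| / 3) *
        (C ^ 2 / 4 + exp (2 * S) * K ^ 2 * sin θ ^ (2 * q - 1) + exp S * (2 * K ^ 2)
        + |Λ| * (A / (4 * π)) ^ 2 * exp S) :=
        add_le_add (mul_le_mul c1 c3 (abs_nonneg _) (by positivity))
          (mul_le_mul c2 b (abs_nonneg _) (by positivity))
    _ = _ := by ring

lemma hasDerivAt_of_contDiffOn {f : ℝ → ℝ} (hf : ContDiffOn ℝ (⊤ : ℕ∞) f (Set.Icc 0 π)) :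
    ∀ θ ∈ Set.Ioo 0 π, HasDerivAt f (deriv f θ) θ := fun _ hθ =>
  ((hf.contDiffAt (Icc_mem_nhds hθ.1 hθ.2)).differentiableAt (by simp)).hasDerivAt

lemma abs_sub_le_sin_sq {f g : ℝ → ℝ} {C : ℝ} (hC : 0 ≤ C)
    (hf : ContDiffOn ℝ (⊤ : ℕ∞) f (Set.Icc 0 π)) (hg : ContDiffOn ℝ (⊤ : ℕ∞) g (Set.Icc 0 π))
    (h0 : f 0 = g 0) (hπ : f π = g π) (hf' : ∀ θ ∈ Set.Ioo 0 π, |deriv f θ| ≤ C * sin θ)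
    (hg' : ∀ θ ∈ Set.Ioo 0 π, |deriv g θ| ≤ C * sin θ) :
    ∀ θ ∈ Set.Ioo 0 π, |f θ - g θ| ≤ C * π * sin θ ^ 2 := by
  intro θ hθ
  have := abs_le_sin_rpow_of_abs_deriv_le (f := fun t => f t - g t)
    (f' := fun t => deriv f t - deriv g t) (C := 2 * C) (p := 1) zero_le_one (by positivity)
    (hf.continuousOn.sub hg.continuousOn)
    (fun t ht => (hasDerivAt_of_contDiffOn hf t ht).sub (hasDerivAt_of_contDiffOn hg t ht))
    (by simp [h0]) (by simp [hπ])
    (fun t ht => by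
      rw [rpow_one]
      linarith [abs_sub (deriv f t) (deriv g t), hf' t ht, hg' t ht]) θ hθ
  rw [show (1 : ℝ) + 1 = (2 : ℕ) by norm_num, rpow_natCast] at this
  linarith

lemma abs_mul_le_rpow {u v c d s p : ℝ} (hp : p ≤ 3) (hs0 : 0 < s) (hs1 : s ≤ 1)
    (hu : |u| ≤ c * s ^ 2) (hv : |v| ≤ d * s) (hc : 0 ≤ c) (hd : 0 ≤ d) :
    |u * v| ≤ c * d * s ^ p := by
  rw [abs_mul]
  calc |u| * |v| ≤ (c * s ^ 2) * (d * s) := by gcongr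
    _ = c * d * s ^ 3 := by ring
    _ ≤ _ := mul_le_mul_of_nonneg_left (pow_three_le_rpow hs0 hs1 hp) (by positivity)

lemma ae_sin_ne (c : ℝ) : ∀ᵐ θ : ℝ, θ ∈ Set.Ioc 0 π → sin θ ≠ c := by
  have hne : ∀ b : ℝ, ∀ᵐ θ : ℝ, θ ≠ b := fun b => by simp [MeasureTheory.ae_iff]
  filter_upwards [hne (arcsin c), hne (π - arcsin c)] with θ hc1 hc2 hθ
  rintro rfl
  rcases le_total θ (π / 2) with h | h
  · exact hc1 (arcsin_sin (by linarith [hθ.1, pi_pos]) h).symm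
  · refine hc2 ?_
    rw [← sin_pi_sub, arcsin_sin (by linarith [hθ.2, pi_pos]) (by linarith)]
    ring

lemma deriv_cutoff_interpolation {f g : ℝ → ℝ} {ε θ d : ℝ}
    (hf : ContDiffOn ℝ (⊤ : ℕ∞) f (Set.Icc 0 π)) (hg : ContDiffOn ℝ (⊤ : ℕ∞) g (Set.Icc 0 π))
    (hθ : θ ∈ Set.Ioo 0 π) (hφ : HasDerivAt (cutoff ε) d θ) :
    deriv (fun θ => g θ + cutoff ε θ * (f θ - g θ)) θ =
      deriv g θ + (d * (f θ - g θ) + cutoff ε θ * (deriv f θ - deriv g θ)) :=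
  ((hasDerivAt_of_contDiffOn hg _ hθ).add (hφ.mul
    ((hasDerivAt_of_contDiffOn hf _ hθ).sub (hasDerivAt_of_contDiffOn hg _ hθ)))).deriv

lemma abs_deriv_cutoff_interpolation_le {f g : ℝ → ℝ} {C ε θ : ℝ}
    (hf : ContDiffOn ℝ (⊤ : ℕ∞) f (Set.Icc 0 π)) (hg : ContDiffOn ℝ (⊤ : ℕ∞) g (Set.Icc 0 π))
    (hfg : ∀ θ ∈ Set.Ioo 0 π, |f θ - g θ| ≤ C * π * sin θ ^ 2)
    (hf' : ∀ θ ∈ Set.Ioo 0 π, |deriv f θ| ≤ C * sin θ)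
    (hg' : ∀ θ ∈ Set.Ioo 0 π, |deriv g θ| ≤ C * sin θ) (hε : ε ∈ Set.Ioo 0 (exp (-2)))
    (hθ : θ ∈ Set.Ioo 0 π) (h1 : sin θ ≠ ε) (h2 : sin θ ≠ √ε) :
    |deriv (fun θ => g θ + cutoff ε θ * (f θ - g θ)) θ| ≤ (C * π + 3 * C) * sin θ := by
  have hs0 : 0 < sin θ := sin_pos_of_mem_Ioo hθ
  obtain ⟨d, hφ, hd⟩ := exists_hasDerivAt_cutoff hε.1 hε.2.le hs0 h1 h2
  obtain ⟨hφ0, hφ1⟩ := cutoff_mem_Icc hε.1 hε.2.le θ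
  rw [deriv_cutoff_interpolation hf hg hθ hφ]
  have e1 : |d * (f θ - g θ)| ≤ C * π * sin θ := by
    rw [abs_mul]
    calc _ ≤ 1 / sin θ * (C * π * sin θ ^ 2) := by
          have := hfg θ hθ
          gcongr
      _ = _ := by field_simp
  have e2 : |cutoff ε θ * (deriv f θ - deriv g θ)| ≤ 1 * (2 * C * sin θ) := by
    rw [abs_mul, abs_of_nonneg hφ0]
    have : |deriv f θ - deriv g θ| ≤ 2 * C * sin θ := by
      linarith [abs_sub (deriv f θ) (deriv g θ), hf' θ hθ, hg' θ hθ]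
    gcongr
  have e3 := hg' θ hθ
  rw [abs_le] at e1 e2 e3 ⊢
  constructor <;> linarith

set_option maxHeartbeats 400000 in
/-- Lemma 4.2: the cut-and-paste approximation `Ψ_ε` leaves the area functional
unchanged in the limit `ε → 0⁺`. -/
theorem statement13 (Λ a A : ℝ) (hΛ : 0 < Λ) (hA : 0 < A)
    (σ ω χ ψ σ₀ ω₀ χ₀ ψ₀ : ℝ → ℝ)
    (hσ : ContDiffOn ℝ (⊤ : ℕ∞) σ (Set.Icc 0 π)) (hω : ContDiffOn ℝ (⊤ : ℕ∞) ω (Set.Icc 0 π))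
    (hχ : ContDiffOn ℝ (⊤ : ℕ∞) χ (Set.Icc 0 π)) (hψ : ContDiffOn ℝ (⊤ : ℕ∞) ψ (Set.Icc 0 π))
    (hσ₀ : ContDiffOn ℝ (⊤ : ℕ∞) σ₀ (Set.Icc 0 π)) (hω₀ : ContDiffOn ℝ (⊤ : ℕ∞) ω₀ (Set.Icc 0 π))
    (hχ₀ : ContDiffOn ℝ (⊤ : ℕ∞) χ₀ (Set.Icc 0 π)) (hψ₀ : ContDiffOn ℝ (⊤ : ℕ∞) ψ₀ (Set.Icc 0 π))
    (hσbd : ∃ C : ℝ, ∀ θ ∈ Set.Icc (0 : ℝ) π, |σ θ| ≤ C)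
    (hσ₀bd : ∃ C : ℝ, ∀ θ ∈ Set.Icc (0 : ℝ) π, |σ₀ θ| ≤ C)
    (hderiv : ∃ C : ℝ, ∀ θ ∈ Set.Icc (0 : ℝ) π,
      |deriv σ θ| ≤ C * Real.sin θ ∧ |deriv ω θ| ≤ C * Real.sin θ ∧
      |deriv χ θ| ≤ C * Real.sin θ ∧ |deriv ψ θ| ≤ C * Real.sin θ ∧
      |deriv ω₀ θ| ≤ C * Real.sin θ ∧ |deriv χ₀ θ| ≤ C * Real.sin θ ∧
      |deriv ψ₀ θ| ≤ C * Real.sin θ)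
    (htwist₀ : ∃ C : ℝ, ∀ θ ∈ Set.Icc (0 : ℝ) π,
      |deriv ω₀ θ + χ₀ θ * deriv ψ₀ θ - ψ₀ θ * deriv χ₀ θ| ≤ C * Real.sin θ ^ 3)
    (htwist : ∃ δ : ℝ, 0 < δ ∧ ∃ C : ℝ, ∀ θ ∈ Set.Icc (0 : ℝ) π,
      |deriv ω θ + χ θ * deriv ψ θ - ψ θ * deriv χ θ| ≤ C * Real.sin θ ^ (1 + δ))
    (hω0 : ω 0 = ω₀ 0) (hωπ : ω π = ω₀ π)
    (hχ0 : χ 0 = χ₀ 0) (hχπ : χ π = χ₀ π)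
    (hψ0 : ψ 0 = ψ₀ 0) (hψπ : ψ π = ψ₀ π) :
    Filter.Tendsto
      (fun ε =>
        areaFunctional Λ a A σ
          (fun θ => ω₀ θ + cutoff ε θ * (ω θ - ω₀ θ))
          (fun θ => χ₀ θ + cutoff ε θ * (χ θ - χ₀ θ))
          (fun θ => ψ₀ θ + cutoff ε θ * (ψ θ - ψ₀ θ)))
      (nhdsWithin 0 (Set.Ioi 0)) (nhds (areaFunctional Λ a A σ ω χ ψ)) := by
  obtain ⟨S, hS⟩ := hσbd
  obtain ⟨C₁, hC₁⟩ := hderiv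
  obtain ⟨C₂, hC₂⟩ := htwist₀
  obtain ⟨δ, hδ, C₃, hC₃⟩ := htwist
  obtain ⟨q, hq, hq2, hqδ⟩ : ∃ q : ℝ, 0 < q ∧ q ≤ 1 / 2 ∧ q ≤ δ :=
    ⟨min (1 / 2) δ, by positivity, min_le_left _ _, min_le_right _ _⟩
  obtain ⟨C, hC, h1C, h2C, h3C⟩ : ∃ C : ℝ, 0 ≤ C ∧ C₁ ≤ C ∧ C₂ ≤ C ∧ C₃ ≤ C :=
    ⟨|C₁| + |C₂| + |C₃|, by positivity,
      by linarith [le_abs_self C₁, abs_nonneg C₂, abs_nonneg C₃],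
      by linarith [le_abs_self C₂, abs_nonneg C₁, abs_nonneg C₃],
      by linarith [le_abs_self C₃, abs_nonneg C₁, abs_nonneg C₂]⟩
  have hs : ∀ θ ∈ Set.Ioo 0 π, 0 < sin θ := fun θ hθ => sin_pos_of_mem_Ioo hθ
  have hder : ∀ θ ∈ Set.Ioo 0 π,
      |deriv σ θ| ≤ C * sin θ ∧ |deriv ω θ| ≤ C * sin θ ∧
      |deriv χ θ| ≤ C * sin θ ∧ |deriv ψ θ| ≤ C * sin θ ∧
      |deriv ω₀ θ| ≤ C * sin θ ∧ |deriv χ₀ θ| ≤ C * sin θ ∧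
      |deriv ψ₀ θ| ≤ C * sin θ := by
    intro θ hθ
    have h := hC₁ θ (Set.Ioo_subset_Icc_self hθ)
    have hm : C₁ * sin θ ≤ C * sin θ := mul_le_mul_of_nonneg_right h1C (hs θ hθ).le
    exact ⟨h.1.trans hm, h.2.1.trans hm, h.2.2.1.trans hm, h.2.2.2.1.trans hm,
      h.2.2.2.2.1.trans hm, h.2.2.2.2.2.1.trans hm, h.2.2.2.2.2.2.trans hm⟩
  have hT₀ : ∀ θ ∈ Set.Ioo 0 π,
      |deriv ω₀ θ + χ₀ θ * deriv ψ₀ θ - ψ₀ θ * deriv χ₀ θ| ≤ C * sin θ ^ (1 + q) := by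
    intro θ hθ
    refine (hC₂ θ (Set.Ioo_subset_Icc_self hθ)).trans ?_
    exact (mul_le_mul_of_nonneg_right h2C (by have := hs θ hθ; positivity)).trans
      (mul_le_mul_of_nonneg_left (pow_three_le_rpow (hs θ hθ) (sin_le_one θ) (by linarith)) hC)
  have hT : ∀ θ ∈ Set.Ioo 0 π,
      |deriv ω θ + χ θ * deriv ψ θ - ψ θ * deriv χ θ| ≤ C * sin θ ^ (1 + q) := by
    intro θ hθ
    refine (hC₃ θ (Set.Ioo_subset_Icc_self hθ)).trans ?_
    exact (mul_le_mul_of_nonneg_right h3C (rpow_nonneg (hs θ hθ).le _)).trans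
      (mul_le_mul_of_nonneg_left (rpow_le_rpow_of_exponent_ge (hs θ hθ) (sin_le_one θ)
        (by linarith)) hC)
  have hx := abs_sub_le_sin_sq hC hχ hχ₀ hχ0 hχπ (fun θ h => (hder θ h).2.2.1)
    (fun θ h => (hder θ h).2.2.2.2.2.1)
  have hy := abs_sub_le_sin_sq hC hψ hψ₀ hψ0 hψπ (fun θ h => (hder θ h).2.2.2.1)
    (fun θ h => (hder θ h).2.2.2.2.2.2)
  -- The combination multiplying the derivative of the cut-off in the twist of `Ψ_ε`.
  obtain ⟨M, hM, hN⟩ : ∃ M : ℝ, 0 ≤ M ∧ ∀ θ ∈ Set.Ioo 0 π,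
      |(ω θ - ω₀ θ) + χ₀ θ * (ψ θ - ψ₀ θ) - ψ₀ θ * (χ θ - χ₀ θ)|
        ≤ M * sin θ ^ (1 + q + 1) := by
    refine ⟨(2 * C + 2 * (C * π * (2 * C))) * (π / 2), by positivity, ?_⟩
    refine abs_le_sin_rpow_of_abs_deriv_le
      (f := fun t => (ω t - ω₀ t) + χ₀ t * (ψ t - ψ₀ t) - ψ₀ t * (χ t - χ₀ t))
      (f' := fun t => (deriv ω t - deriv ω₀ t)
        + (deriv χ₀ t * (ψ t - ψ₀ t) + χ₀ t * (deriv ψ t - deriv ψ₀ t))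
        - (deriv ψ₀ t * (χ t - χ₀ t) + ψ₀ t * (deriv χ t - deriv χ₀ t)))
      (by linarith) (by positivity) ?_ ?_ (by simp [hω0, hχ0, hψ0]) (by simp [hωπ, hχπ, hψπ]) ?_
    · exact ((hω.continuousOn.sub hω₀.continuousOn).add (hχ₀.continuousOn.mul
        (hψ.continuousOn.sub hψ₀.continuousOn))).sub (hψ₀.continuousOn.mul
        (hχ.continuousOn.sub hχ₀.continuousOn))
    · intro t ht
      have hd : ∀ {f : ℝ → ℝ}, ContDiffOn ℝ (⊤ : ℕ∞) f (Set.Icc 0 π) →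
          HasDerivAt f (deriv f t) t := fun hf => hasDerivAt_of_contDiffOn hf t ht
      exact (((hd hω).sub (hd hω₀)).add ((hd hχ₀).mul
        ((hd hψ).sub (hd hψ₀)))).sub ((hd hψ₀).mul
        ((hd hχ).sub (hd hχ₀)))
    · intro t ht
      obtain ⟨-, -, h3, h4, -, h6, h7⟩ := hder t ht
      have e1 := abs_mul_le_rpow (p := 1 + q) (by linarith) (hs t ht) (sin_le_one t) (hx t ht)
        (v := deriv ψ t + deriv ψ₀ t) (d := 2 * C)
        ((abs_add_le _ _).trans (by linarith)) (by positivity) (by positivity)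
      have e2 := abs_mul_le_rpow (p := 1 + q) (by linarith) (hs t ht) (sin_le_one t) (hy t ht)
        (v := deriv χ t + deriv χ₀ t) (d := 2 * C)
        ((abs_add_le _ _).trans (by linarith)) (by positivity) (by positivity)
      have e3 := hT t ht
      have e4 := hT₀ t ht
      rw [abs_le] at e1 e2 e3 e4 ⊢
      constructor <;> linarith
  have hε₀ : ∀ᶠ ε : ℝ in nhdsWithin 0 (Set.Ioi 0), ε ∈ Set.Ioo 0 (exp (-2)) :=
    Ioo_mem_nhdsGT (exp_pos _)
  obtain ⟨K, hK, hTε, hχε, hψε⟩ : ∃ K : ℝ, 0 ≤ K ∧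
      (∀ ε ∈ Set.Ioo 0 (exp (-2)), ∀ θ ∈ Set.Ioo 0 π, sin θ ≠ ε → sin θ ≠ √ε →
        |deriv (fun θ => ω₀ θ + cutoff ε θ * (ω θ - ω₀ θ)) θ
          + (χ₀ θ + cutoff ε θ * (χ θ - χ₀ θ)) *
            deriv (fun θ => ψ₀ θ + cutoff ε θ * (ψ θ - ψ₀ θ)) θ
          - (ψ₀ θ + cutoff ε θ * (ψ θ - ψ₀ θ)) *
            deriv (fun θ => χ₀ θ + cutoff ε θ * (χ θ - χ₀ θ)) θ| ≤ K * sin θ ^ (1 + q)) ∧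
      (∀ ε ∈ Set.Ioo 0 (exp (-2)), ∀ θ ∈ Set.Ioo 0 π, sin θ ≠ ε → sin θ ≠ √ε →
        |deriv (fun θ => χ₀ θ + cutoff ε θ * (χ θ - χ₀ θ)) θ| ≤ K * sin θ) ∧
      (∀ ε ∈ Set.Ioo 0 (exp (-2)), ∀ θ ∈ Set.Ioo 0 π, sin θ ≠ ε → sin θ ≠ √ε →
        |deriv (fun θ => ψ₀ θ + cutoff ε θ * (ψ θ - ψ₀ θ)) θ| ≤ K * sin θ) := by
    have hlin : ∀ {u s : ℝ}, 0 < s → |u| ≤ (C * π + 3 * C) * s →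
        |u| ≤ (2 * C + 2 * (C * π * (2 * C)) + C * π + M + 3 * C) * s := fun hs hu =>
      hu.trans (mul_le_mul_of_nonneg_right
        (by have : 0 ≤ C * π * (2 * C) := by positivity
            linarith) hs.le)
    refine ⟨_, by positivity, ?_,
      fun ε hε θ hθ h1 h2 => hlin (hs θ hθ) (abs_deriv_cutoff_interpolation_le hχ hχ₀ hx
        (fun θ h => (hder θ h).2.2.1) (fun θ h => (hder θ h).2.2.2.2.2.1) hε hθ h1 h2),
      fun ε hε θ hθ h1 h2 => hlin (hs θ hθ) (abs_deriv_cutoff_interpolation_le hψ hψ₀ hy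
        (fun θ h => (hder θ h).2.2.2.1) (fun θ h => (hder θ h).2.2.2.2.2.2) hε hθ h1 h2)⟩
    intro ε hε θ hθ h1 h2
    obtain ⟨φ', hφ, hφ'⟩ := exists_hasDerivAt_cutoff hε.1 hε.2.le (hs θ hθ) h1 h2
    obtain ⟨hφ0, hφ1⟩ := cutoff_mem_Icc hε.1 hε.2.le θ
    have hs0 := hs θ hθ
    obtain ⟨-, -, h3, h4, -, h6, h7⟩ := hder θ hθ
    rw [deriv_cutoff_interpolation hω hω₀ hθ hφ, deriv_cutoff_interpolation hχ hχ₀ hθ hφ,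
      deriv_cutoff_interpolation hψ hψ₀ hθ hφ]
    have e1 := abs_mul_le_rpow (p := 1 + q) (by linarith) hs0 (sin_le_one θ) (hx θ hθ)
      (v := deriv ψ θ - deriv ψ₀ θ) (d := 2 * C)
      ((abs_sub _ _).trans (by linarith)) (by positivity) (by positivity)
    have e2 := abs_mul_le_rpow (p := 1 + q) (by linarith) hs0 (sin_le_one θ) (hy θ hθ)
      (v := deriv χ θ - deriv χ₀ θ) (d := 2 * C)
      ((abs_sub _ _).trans (by linarith)) (by positivity) (by positivity)
    have e3 := hT θ hθ
    have e4 := hT₀ θ hθ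
    have e5 : |φ' * ((ω θ - ω₀ θ) + χ₀ θ * (ψ θ - ψ₀ θ) - ψ₀ θ * (χ θ - χ₀ θ))|
        ≤ M * sin θ ^ (1 + q) := by
      rw [abs_mul]
      calc _ ≤ 1 / sin θ * (M * sin θ ^ (1 + q + 1)) := by
            have := hN θ hθ
            gcongr
        _ = _ := by rw [rpow_add_one hs0.ne']; field_simp
    have e6 : 0 ≤ sin θ ^ (1 + q) := by positivity
    set φ := cutoff ε θ
    set P := sin θ ^ (1 + q)
    have hmul : ∀ {c u B : ℝ}, 0 ≤ c → c ≤ 1 → |u| ≤ B → |c * u| ≤ B := by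
      intro c u B hc0 hc1 hu
      rw [abs_mul, abs_of_nonneg hc0]
      nlinarith [abs_nonneg u]
    have f1 := hmul (c := φ * (1 - φ)) (by nlinarith) (by nlinarith) e1
    have f2 := hmul (c := φ * (1 - φ)) (by nlinarith) (by nlinarith) e2
    have f3 := hmul hφ0 hφ1 e3
    have f4 := hmul (c := 1 - φ) (by linarith) (by linarith) e4
    have e7 : 0 ≤ (C * π + 3 * C) * P := by positivity
    rw [abs_le] at f1 f2 f3 f4 e5 ⊢
    constructor <;> linarith
  unfold areaFunctional
  have hint := intervalIntegrable_sin_rpow (r := 2 * q - 1) (by linarith) (by linarith)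
  obtain ⟨B₁, B₂, hB⟩ := exists_abs_areaDensity_le Λ a A q S C K
  refine intervalIntegral.tendsto_integral_filter_of_dominated_convergence
    (fun θ => B₁ + B₂ * sin θ ^ (2 * q - 1)) ?_ ?_ (intervalIntegrable_const.add
      (hint.const_mul _)) ?_
  · refine Filter.Eventually.of_forall fun ε => ?_
    rw [Set.uIoc_of_le pi_pos.le]
    have hm : ∀ {f : ℝ → ℝ}, ContDiffOn ℝ (⊤ : ℕ∞) f (Set.Icc 0 π) →
        AEMeasurable f (MeasureTheory.volume.restrict (Set.Ioc 0 π)) := fun hf =>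
      ((hf.continuousOn.mono Set.Ioc_subset_Icc_self).aemeasurable measurableSet_Ioc)
    have hmσ := hm hσ
    have hmχ := hm hχ
    have hmψ := hm hψ
    have hmχ₀ := hm hχ₀
    have hmψ₀ := hm hψ₀
    have hmφ := (measurable_cutoff ε).aemeasurable
      (μ := MeasureTheory.volume.restrict (Set.Ioc 0 π))
    have hmd : ∀ f : ℝ → ℝ, AEMeasurable (fun θ => deriv f θ)
        (MeasureTheory.volume.restrict (Set.Ioc 0 π)) := fun f =>
      (measurable_deriv f).aemeasurable
    have hd1 := hmd σ
    have hd2 := hmd (fun θ => ω₀ θ + cutoff ε θ * (ω θ - ω₀ θ))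
    have hd3 := hmd (fun θ => χ₀ θ + cutoff ε θ * (χ θ - χ₀ θ))
    have hd4 := hmd (fun θ => ψ₀ θ + cutoff ε θ * (ψ θ - ψ₀ θ))
    refine AEMeasurable.aestronglyMeasurable ?_
    generalize deriv (fun θ => ω₀ θ + cutoff ε θ * (ω θ - ω₀ θ)) = w at *
    generalize deriv (fun θ => χ₀ θ + cutoff ε θ * (χ θ - χ₀ θ)) = x at *
    generalize deriv (fun θ => ψ₀ θ + cutoff ε θ * (ψ θ - ψ₀ θ)) = y at *
    generalize deriv σ = z at *
    fun_prop
  · filter_upwards [hε₀] with ε hε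
    have hneπ : ∀ᵐ θ : ℝ, θ ≠ π := by simp [MeasureTheory.ae_iff]
    filter_upwards [ae_sin_ne ε, ae_sin_ne √ε, hneπ] with θ h1 h2 h5 hθ
    rw [Set.uIoc_of_le pi_pos.le] at hθ
    replace h1 := h1 hθ
    replace h2 := h2 hθ
    have hθ' : θ ∈ Set.Ioo 0 π := ⟨hθ.1, lt_of_le_of_ne hθ.2 h5⟩
    exact hB θ _ _ _ _ _ (hs θ hθ') (hS θ (Set.Ioo_subset_Icc_self hθ')) (hder θ hθ').1
      (hTε ε hε θ hθ' h1 h2) (hχε ε hε θ hθ' h1 h2) (hψε ε hε θ hθ' h1 h2)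
  · have hneπ : ∀ᵐ θ : ℝ, θ ≠ π := by simp [MeasureTheory.ae_iff]
    filter_upwards [hneπ] with θ hne hθ
    rw [Set.uIoc_of_le pi_pos.le] at hθ
    have hs0 := hs θ ⟨hθ.1, lt_of_le_of_ne hθ.2 hne⟩
    refine tendsto_const_nhds.congr' ?_
    filter_upwards [hε₀, Ioo_mem_nhdsGT (show (0 : ℝ) < sin θ ^ 2 by positivity)] with ε hε hε'
    have hcut := cutoff_eventuallyEq_one hε.1 (hε.2.le.trans (exp_le_one_iff.2 (by norm_num)))
      ((sqrt_lt' hs0).2 hε'.2)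
    have heq : ∀ f g : ℝ → ℝ, (fun t => g t + cutoff ε t * (f t - g t)) =ᶠ[nhds θ] f := by
      intro f g
      filter_upwards [hcut] with t ht
      rw [ht]; ring
    simp only [(heq ω ω₀).deriv_eq, (heq χ χ₀).deriv_eq, (heq ψ ψ₀).deriv_eq, hcut.eq_of_nhds,
      one_mul, add_sub_cancel]
end
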